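/- arXiv:2203.03229 — 2 statements merged into one kernel-verified Lean document; each statement's English description precedes it below -/
import Mathlib

section
/- Let t ≥ 2, h a natural number, and let H be a graph with no K_{2,t} minor. Let Q be a subset of the vertices of H, and let Q_h denote the set of vertices lying on Q-paths in H of length at most h. Then |Q_h| ≤ α·|Q| for some constant α depending only on h and t; in particular one may take α = (t+1)^{2h}·(h+1)!. -/
open SimpleGraph

def SimpleGraph.HasMinor {V W : Type*} (G : SimpleGraph V) (H : SimpleGraph W) : Prop :=
  ∃ B : W → Set V,
    (∀ w, (B w).Nonempty) ∧
    (∀ w, (G.induce (B w)).Connected) ∧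
    (Pairwise fun w₁ w₂ => Disjoint (B w₁) (B w₂)) ∧
    (∀ w₁ w₂, H.Adj w₁ w₂ → ∃ a ∈ B w₁, ∃ b ∈ B w₂, G.Adj a b)

/-- The set of vertices lying on `Q`-paths of length at most `h` in `G`.  A `Q`-path is a
path whose intersection with `Q` is exactly its set of endpoints; a single vertex of `Q`
is a trivial `Q`-path of length `0`. -/
def qPathVerts {V : Type*} (G : SimpleGraph V) (Q : Set V) (h : ℕ) : Set V :=
  {x | ∃ u v : V, ∃ p : G.Walk u v, p.IsPath ∧ u ∈ Q ∧ v ∈ Q ∧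
    (∀ y ∈ p.support, y ∈ Q → y = u ∨ y = v) ∧ p.length ≤ h ∧ x ∈ p.support}

namespace SimpleGraph

variable {V : Type*} {G : SimpleGraph V}

/-- Some edge of `G` joins a vertex of `A` to a vertex of `B`. -/
def Touches (G : SimpleGraph V) (A B : Set V) : Prop :=
  ∃ a ∈ A, ∃ b ∈ B, G.Adj a b

lemma Touches.symm {A B : Set V} (h : G.Touches A B) : G.Touches B A := by
  obtain ⟨a, ha, b, hb, hab⟩ := h
  exact ⟨b, hb, a, ha, hab.symm⟩

lemma Touches.mono_left {A A' B : Set V} (h : G.Touches A B) (hA : A ⊆ A') :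
    G.Touches A' B := by
  obtain ⟨a, ha, b, hb, hab⟩ := h
  exact ⟨a, hA ha, b, hb, hab⟩

lemma Touches.connected_induce_union {A B : Set V} (h : G.Touches A B)
    (hA : (G.induce A).Connected) (hB : (G.induce B).Connected) :
    (G.induce (A ∪ B)).Connected := by
  obtain ⟨a, ha, b, hb, hab⟩ := h
  exact SimpleGraph.connected_induce_union hA.preconnected hB.preconnected ha hb hab

/-- Two disjoint connected sets with `t` pairwise disjoint connected common neighbours form a
`K_{2,t}` minor. -/
lemma hasMinor_completeBipartiteGraph_two {t : ℕ} {A B : Set V} (C : Fin t → Set V)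
    (hA : (G.induce A).Connected) (hB : (G.induce B).Connected)
    (hC : ∀ i, (G.induce (C i)).Connected) (hAB : Disjoint A B)
    (hAC : ∀ i, Disjoint A (C i)) (hBC : ∀ i, Disjoint B (C i))
    (hCC : Pairwise fun i j => Disjoint (C i) (C j))
    (tA : ∀ i, G.Touches A (C i)) (tB : ∀ i, G.Touches B (C i)) :
    G.HasMinor (completeBipartiteGraph (Fin 2) (Fin t)) := by
  have hconn : ∀ w, (G.induce (Sum.elim ![A, B] C w)).Connected := by
    rintro (i | i)
    · fin_cases i
      · exact hA
      · exact hB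
    · exact hC i
  have htouch : ∀ i j, G.Touches (![A, B] i) (C j) := by
    intro i j
    fin_cases i
    · exact tA j
    · exact tB j
  refine ⟨Sum.elim ![A, B] C, fun w => Set.nonempty_coe_sort.1 (hconn w).nonempty, hconn, ?_, ?_⟩
  · have hdisj : ∀ i j, Disjoint (![A, B] i) (C j) := by
      intro i j
      fin_cases i
      · exact hAC j
      · exact hBC j
    rintro (i | i) (j | j) hij
    · fin_cases i <;> fin_cases j
      · exact absurd rfl hij
      · exact hAB
      · exact hAB.symm
      · exact absurd rfl hij
    · exact hdisj i j
    · exact (hdisj j i).symm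
    · exact hCC fun h => hij (congrArg _ h)
  · rintro (i | i) (j | j) hij
    · simp at hij
    · exact htouch i j
    · exact (htouch j i).symm
    · simp at hij

/-- In a `K_{2,t}`-minor-free graph, a family `𝓒` of disjoint connected sets, each touching two
members of a family `𝓑` of disjoint connected sets, has at most `t * #𝓑` members. -/
lemma card_le_of_touches_two {t : ℕ}
    (hfree : ¬ G.HasMinor (completeBipartiteGraph (Fin 2) (Fin t))) (𝓑 𝓒 : Finset (Set V))
    (h𝓑 : ∀ B ∈ 𝓑, (G.induce B).Connected) (h𝓒 : ∀ C ∈ 𝓒, (G.induce C).Connected)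
    (d𝓑 : ∀ A ∈ 𝓑, ∀ B ∈ 𝓑, A ≠ B → Disjoint A B)
    (d𝓒 : ∀ C ∈ 𝓒, ∀ D ∈ 𝓒, C ≠ D → Disjoint C D)
    (d𝓑𝓒 : ∀ B ∈ 𝓑, ∀ C ∈ 𝓒, Disjoint B C)
    (htouch : ∀ C ∈ 𝓒, ∃ A ∈ 𝓑, ∃ B ∈ 𝓑, A ≠ B ∧ G.Touches A C ∧ G.Touches B C) :
    𝓒.card ≤ t * 𝓑.card := by
  classical
  induction hn : 𝓑.card generalizing 𝓑 𝓒 with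
  | zero =>
    obtain rfl := Finset.card_eq_zero.1 hn
    rcases 𝓒.eq_empty_or_nonempty with rfl | ⟨C, hC⟩
    · simp
    · obtain ⟨A, hA, -⟩ := htouch C hC
      simp at hA
  | succ n ih =>
    rcases 𝓒.eq_empty_or_nonempty with rfl | ⟨C, hC⟩
    · simp
    obtain ⟨A, hA, B, hB, hAB, tA, tB⟩ := htouch C hC
    set 𝓓 := 𝓒.filter fun D => G.Touches A D ∧ G.Touches B D with h𝓓
    have hCD : C ∈ 𝓓 := Finset.mem_filter.2 ⟨hC, tA, tB⟩
    have hcard𝓓 : 𝓓.card ≤ t := by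
      by_contra! hlt
      obtain ⟨𝓔, h𝓔, hcard⟩ := Finset.exists_subset_card_eq hlt.le
      let e := (𝓔.equivFinOfCardEq hcard).symm
      have he : ∀ i, (e i : Set V) ∈ 𝓒 ∧ G.Touches A (e i) ∧ G.Touches B (e i) :=
        fun i => Finset.mem_filter.1 (h𝓔 (e i).2)
      exact hfree <| hasMinor_completeBipartiteGraph_two (fun i => (e i : Set V)) (h𝓑 A hA)
        (h𝓑 B hB) (fun i => h𝓒 _ (he i).1) (d𝓑 A hA B hB hAB)
        (fun i => d𝓑𝓒 A hA _ (he i).1) (fun i => d𝓑𝓒 B hB _ (he i).1)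
        (fun i j hij => d𝓒 _ (he i).1 _ (he j).1 fun h => hij (e.injective (Subtype.ext h)))
        (fun i => (he i).2.1) (fun i => (he i).2.2)
    set U := A ∪ C ∪ B with hU
    have hUconn : (G.induce U).Connected :=
      (tB.symm.mono_left Set.subset_union_right).connected_induce_union
        (tA.connected_induce_union (h𝓑 A hA) (h𝓒 C hC)) (h𝓑 B hB)
    have hAU : A ⊆ U := fun x hx => Or.inl (Or.inl hx)
    have hBU : B ⊆ U := fun x hx => Or.inr hx
    set 𝓡 := (𝓑.erase A).erase B with h𝓡
    have mem𝓡 : ∀ X, X ∈ 𝓡 ↔ X ≠ B ∧ X ≠ A ∧ X ∈ 𝓑 := by simp [h𝓡]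
    have dU : ∀ X ∈ 𝓡, Disjoint U X := by
      intro X hX
      obtain ⟨hXB, hXA, hX⟩ := (mem𝓡 X).1 hX
      exact ((d𝓑 A hA X hX hXA.symm).union_left (d𝓑𝓒 X hX C hC).symm).union_left
        (d𝓑 B hB X hX hXB.symm)
    have hU𝓡 : U ∉ 𝓡 := fun h => by
      have hUe : U = ∅ := by simpa using dU U h
      exact (Set.nonempty_coe_sort.1 hUconn.nonempty).ne_empty hUe
    have hcard : (insert U 𝓡).card = n := by
      rw [Finset.card_insert_of_notMem hU𝓡, h𝓡,
        Finset.card_erase_of_mem (Finset.mem_erase.2 ⟨hAB.symm, hB⟩), Finset.card_erase_of_mem hA]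
      have : 1 < 𝓑.card := Finset.one_lt_card.2 ⟨A, hA, B, hB, hAB⟩
      omega
    have key := ih (insert U 𝓡) (𝓒 \ 𝓓) ?_ ?_ ?_ ?_ ?_ ?_ hcard
    · have := Finset.card_le_card_sdiff_add_card (s := 𝓒) (t := 𝓓)
      rw [mul_add]
      omega
    · intro X hX
      rcases Finset.mem_insert.1 hX with rfl | hX
      · exact hUconn
      · exact h𝓑 X ((mem𝓡 X).1 hX).2.2
    · exact fun D hD => h𝓒 D (Finset.mem_sdiff.1 hD).1
    · intro X hX Y hY hXY
      rcases Finset.mem_insert.1 hX with rfl | hX <;> rcases Finset.mem_insert.1 hY with rfl | hY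
      · exact absurd rfl hXY
      · exact dU Y hY
      · exact (dU X hX).symm
      · exact d𝓑 X ((mem𝓡 X).1 hX).2.2 Y ((mem𝓡 Y).1 hY).2.2 hXY
    · exact fun D hD E hE => d𝓒 D (Finset.mem_sdiff.1 hD).1 E (Finset.mem_sdiff.1 hE).1
    · intro X hX D hD
      obtain ⟨hD, hD𝓓⟩ := Finset.mem_sdiff.1 hD
      rcases Finset.mem_insert.1 hX with rfl | hX
      · exact ((d𝓑𝓒 A hA D hD).union_left
          (d𝓒 C hC D hD fun h => hD𝓓 (h ▸ hCD))).union_left (d𝓑𝓒 B hB D hD)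
      · exact d𝓑𝓒 X ((mem𝓡 X).1 hX).2.2 D hD
    · intro D hD
      obtain ⟨hD, hD𝓓⟩ := Finset.mem_sdiff.1 hD
      have hnot : ¬ (G.Touches A D ∧ G.Touches B D) := fun h => hD𝓓 (Finset.mem_filter.2 ⟨hD, h⟩)
      obtain ⟨X, hX, Y, hY, hXY, tX, tY⟩ := htouch D hD
      have hins : ∀ Z ∈ 𝓡, Z ∈ insert U 𝓡 := fun Z hZ => Finset.mem_insert_of_mem hZ
      have hne : ∀ Z ∈ 𝓡, U ≠ Z := fun Z hZ h => hU𝓡 (h ▸ hZ)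
      have hUD : ∀ Z, Z = A ∨ Z = B → G.Touches Z D → G.Touches U D := by
        rintro Z (rfl | rfl) hZ
        · exact hZ.mono_left hAU
        · exact hZ.mono_left hBU
      by_cases hX' : X = A ∨ X = B <;> by_cases hY' : Y = A ∨ Y = B
      · exfalso
        rcases hX' with rfl | rfl <;> rcases hY' with rfl | rfl <;> tauto
      · have hY𝓡 : Y ∈ 𝓡 := (mem𝓡 Y).2 (by tauto)
        exact ⟨U, Finset.mem_insert_self _ _, Y, hins Y hY𝓡, hne Y hY𝓡, hUD X hX' tX, tY⟩
      · have hX𝓡 : X ∈ 𝓡 := (mem𝓡 X).2 (by tauto)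
        exact ⟨U, Finset.mem_insert_self _ _, X, hins X hX𝓡, hne X hX𝓡, hUD Y hY' tY, tX⟩
      · exact ⟨X, hins X ((mem𝓡 X).2 (by tauto)), Y, hins Y ((mem𝓡 Y).2 (by tauto)), hXY, tX, tY⟩

/-- Every vertex of a path lies on one of the two pieces obtained by splitting it at an inner
vertex, and both pieces are shorter. -/
lemma Walk.IsPath.exists_shorter_of_mem_support {u v x y : V} {p : G.Walk u v} (hp : p.IsPath)
    (hx : x ∈ p.support) (hy : y ∈ p.support) (hyu : y ≠ u) (hyv : y ≠ v) :
    (∃ q : G.Walk u y, q.IsPath ∧ q.length < p.length ∧ x ∈ q.support) ∨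
      ∃ q : G.Walk y v, q.IsPath ∧ q.length < p.length ∧ x ∈ q.support := by
  classical
  rw [← p.take_spec hy, Walk.mem_support_append_iff] at hx
  exact hx.imp
    (fun h => ⟨_, hp.takeUntil hy, Walk.length_takeUntil_lt_length hy hyv, h⟩)
    (fun h => ⟨_, hp.dropUntil hy, Walk.length_dropUntil_lt_length hy hyu, h⟩)

lemma Walk.IsPath.mem_qPathVerts {R : Set V} {n : ℕ} {u v x : V} {p : G.Walk u v} (hp : p.IsPath)
    (hu : u ∈ R) (hv : v ∈ R) (hn : p.length ≤ n) (hx : x ∈ p.support) :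
    x ∈ qPathVerts G R n := by
  induction hl : p.length using Nat.strong_induction_on generalizing u v with
  | _ l ih =>
    by_cases hinner : ∀ y ∈ p.support, y ∈ R → y = u ∨ y = v
    · exact ⟨u, v, p, hp, hu, hv, hinner, hn, hx⟩
    · push Not at hinner
      obtain ⟨y, hy, hyR, hyu, hyv⟩ := hinner
      rcases hp.exists_shorter_of_mem_support hx hy hyu hyv with ⟨q, hq, hlt, hxq⟩ | ⟨q, hq, hlt, hxq⟩
      · exact ih _ (hl ▸ hlt) hq hu hyR (by omega) hxq rfl
      · exact ih _ (hl ▸ hlt) hq hyR hv (by omega) hxq rfl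

/-- The inner vertices of a path with at least one inner vertex form a connected set touching
both ends. -/
lemma Walk.IsPath.exists_connected_interior {u v x : V} {p : G.Walk u v} (hp : p.IsPath)
    (hx : x ∈ p.support) (hxu : x ≠ u) (hxv : x ≠ v) :
    ∃ C : Set V, (G.induce C).Connected ∧ (∀ y ∈ C, y ∈ p.support ∧ y ≠ u ∧ y ≠ v) ∧
      C.ncard + 1 ≤ p.length ∧ u ≠ v ∧ G.Touches {u} C ∧ G.Touches {v} C := by
  classical
  cases p with
  | nil => simp_all
  | cons hadj q =>
    cases q with
    | nil => simp_all
    | cons hadj' r =>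
      obtain ⟨w, s, hs, heq⟩ := Walk.exists_cons_eq_concat hadj' r
      rw [heq] at hp ⊢
      obtain ⟨hps, hu⟩ := (Walk.cons_isPath_iff _ _).1 hp
      obtain ⟨-, hv⟩ := (Walk.concat_isPath_iff _).1 hps
      rw [Walk.support_concat, List.mem_append, List.mem_singleton, not_or] at hu
      refine ⟨{y | y ∈ s.support}, s.connected_induce_support, fun y hy => ⟨?_, ?_, ?_⟩, ?_, hu.2,
        ⟨u, rfl, _, s.start_mem_support, hadj⟩, ⟨v, rfl, _, s.end_mem_support, hs.symm⟩⟩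
      · have hy' : y ∈ s.support := hy
        simp [Walk.support_concat, hy']
      · rintro rfl
        exact hu.1 hy
      · rintro rfl
        exact hv hy
      · have h₁ : {y | y ∈ s.support} = (s.support.toFinset : Set V) := by ext; simp
        have h₂ := s.support.toFinset_card_le
        rw [Walk.length_support] at h₂
        rw [h₁, Set.ncard_coe_finset, Walk.length_cons, Walk.length_concat]
        omega

/-- Adding the inner vertices of a maximal family of disjoint inner parts of `Q`-paths to `Q`
shortens the paths needed by one. -/
lemma exists_qPathVerts_succ_subset [Finite V] {t : ℕ}
    (hfree : ¬ G.HasMinor (completeBipartiteGraph (Fin 2) (Fin t))) (Q : Set V) (k : ℕ) :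
    ∃ R : Set V, qPathVerts G Q (k + 1) ⊆ qPathVerts G R k ∧
      R.ncard ≤ (t * k + 1) * Q.ncard := by
  classical
  let P : Finset (Set V) → Prop := fun 𝓒 =>
    (∀ C ∈ 𝓒, (G.induce C).Connected ∧ Disjoint Q C ∧ C.ncard ≤ k ∧
      ∃ u ∈ Q, ∃ v ∈ Q, u ≠ v ∧ G.Touches {u} C ∧ G.Touches {v} C) ∧
    ∀ C ∈ 𝓒, ∀ D ∈ 𝓒, C ≠ D → Disjoint C D
  obtain ⟨𝓒, -, h𝓒⟩ := (Set.toFinite {𝓒 | P 𝓒}).exists_le_maximal (a := ∅) (by simp [P])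
  obtain ⟨hgood, hdisj⟩ : P 𝓒 := h𝓒.prop
  refine ⟨Q ∪ ⋃ C ∈ 𝓒, C, ?_, ?_⟩
  · rintro x ⟨u, v, p, hp, hu, hv, hinner, hlen, hx⟩
    by_cases hy : ∃ y ∈ p.support, y ∈ Q ∪ ⋃ C ∈ 𝓒, C ∧ y ≠ u ∧ y ≠ v
    · obtain ⟨y, hy, hyR, hyu, hyv⟩ := hy
      rcases hp.exists_shorter_of_mem_support hx hy hyu hyv with ⟨q, hq, hlt, hxq⟩ | ⟨q, hq, hlt, hxq⟩
      · exact hq.mem_qPathVerts (Or.inl hu) hyR (by omega) hxq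
      · exact hq.mem_qPathVerts hyR (Or.inl hv) (by omega) hxq
    · push Not at hy
      by_cases hxQ : x ∈ Q
      · exact Walk.IsPath.nil.mem_qPathVerts (Or.inl hxQ) (Or.inl hxQ) (by simp)
          (Walk.start_mem_support _)
      exfalso
      obtain ⟨C, hC, hCp, hCk, huv, tu, tv⟩ := hp.exists_connected_interior hx
        (fun h => hxQ (h ▸ hu)) (fun h => hxQ (h ▸ hv))
      have hnot : ∀ z ∈ C, z ∉ Q ∪ ⋃ C ∈ 𝓒, C := fun z hz hzR =>
        (hCp z hz).2.2 (hy z (hCp z hz).1 hzR (hCp z hz).2.1)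
      have hCd : ∀ D ∈ 𝓒, Disjoint C D := fun D hD => Set.disjoint_left.2 fun z hz hzD =>
        hnot z hz (Or.inr (Set.mem_biUnion hD hzD))
      have hins : P (insert C 𝓒) := by
        constructor
        · intro D hD
          rcases Finset.mem_insert.1 hD with rfl | hD
          · exact ⟨hC, Set.disjoint_right.2 fun z hz hzQ => hnot z hz (Or.inl hzQ), by omega,
              u, hu, v, hv, huv, tu, tv⟩
          · exact hgood D hD
        · intro D hD E hE hDE
          rcases Finset.mem_insert.1 hD with rfl | hD' <;>
            rcases Finset.mem_insert.1 hE with rfl | hE'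
          · exact absurd rfl hDE
          · exact hCd E hE'
          · exact (hCd D hD').symm
          · exact hdisj D hD' E hE' hDE
      have hC𝓒 : C ∈ 𝓒 :=
        h𝓒.le_of_ge hins (Finset.subset_insert C 𝓒) (Finset.mem_insert_self C 𝓒)
      obtain ⟨z, hz⟩ := Set.nonempty_coe_sort.1 hC.nonempty
      exact hnot z hz (Or.inr (Set.mem_biUnion hC𝓒 hz))
  · have hcard𝓒 : 𝓒.card ≤ t * Q.ncard := by
      let 𝓑 : Finset (Set V) := (Set.toFinite Q).toFinset.image fun q => {q}
      have h𝓑 : 𝓑.card ≤ Q.ncard := by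
        rw [Set.ncard_eq_toFinset_card Q]
        exact Finset.card_image_le
      have mem𝓑 : ∀ B ∈ 𝓑, ∃ q ∈ Q, {q} = B := by simp [𝓑]
      refine le_trans (card_le_of_touches_two hfree 𝓑 𝓒 ?_ (fun C hC => (hgood C hC).1) ?_ hdisj
        ?_ ?_) (Nat.mul_le_mul_left t h𝓑)
      · intro B hB
        obtain ⟨q, -, rfl⟩ := mem𝓑 B hB
        simp [connected_top]
      · intro A hA B hB hAB
        obtain ⟨a, -, rfl⟩ := mem𝓑 A hA
        obtain ⟨b, -, rfl⟩ := mem𝓑 B hB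
        exact Set.disjoint_singleton.2 fun h => hAB (h ▸ rfl)
      · intro B hB C hC
        obtain ⟨q, hq, rfl⟩ := mem𝓑 B hB
        exact (hgood C hC).2.1.mono_left (Set.singleton_subset_iff.2 hq)
      · intro C hC
        obtain ⟨-, -, -, u, hu, v, hv, huv, tu, tv⟩ := hgood C hC
        exact ⟨{u}, by simpa [𝓑] using hu, {v}, by simpa [𝓑] using hv, by simpa using huv, tu, tv⟩
    have hunion : (⋃ C ∈ 𝓒, C).ncard ≤ 𝓒.card * k :=
      (Finset.set_ncard_biUnion_le 𝓒 fun C => C).trans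
        (Finset.sum_le_card_nsmul _ _ _ fun C hC => (hgood C hC).2.2.1)
    calc (Q ∪ ⋃ C ∈ 𝓒, C).ncard ≤ Q.ncard + (⋃ C ∈ 𝓒, C).ncard := Set.ncard_union_le _ _
      _ ≤ Q.ncard + t * Q.ncard * k := by
        gcongr
        exact hunion.trans (Nat.mul_le_mul_right k hcard𝓒)
      _ = (t * k + 1) * Q.ncard := by ring

end SimpleGraph

/-- In a `K_{2,t}`-minor-free graph the number of vertices on `Q`-paths of length at most
`h` is at most `α_{h,t}·|Q|`, where one may take `α_{h,t} = (t+1)^{2h}·(h+1)!`. -/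
theorem qPathVerts_card_le {V : Type*} [Fintype V]
    (t h : ℕ) (ht : 2 ≤ t) (H : SimpleGraph V)
    (hfree : ¬ H.HasMinor (completeBipartiteGraph (Fin 2) (Fin t)))
    (Q : Set V) :
    (qPathVerts H Q h).ncard ≤ (t + 1) ^ (2 * h) * Nat.factorial (h + 1) * Q.ncard := by
  induction h generalizing Q with
  | zero =>
    have hsub : qPathVerts H Q 0 ⊆ Q := by
      rintro x ⟨u, v, p, -, hu, -, -, hlen, hx⟩
      cases p with
      | nil => simpa [(Walk.mem_support_nil_iff).1 hx] using hu
      | cons => simp at hlen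
    simpa using Set.ncard_le_ncard hsub
  | succ k ih =>
    obtain ⟨R, hsub, hR⟩ := exists_qPathVerts_succ_subset hfree Q k
    have hfactor : t * k + 1 ≤ (t + 1) ^ 2 * (k + 2) := by nlinarith [Nat.zero_le (t * t * k)]
    calc (qPathVerts H Q (k + 1)).ncard ≤ (qPathVerts H R k).ncard := Set.ncard_le_ncard hsub
      _ ≤ (t + 1) ^ (2 * k) * Nat.factorial (k + 1) * R.ncard := ih R
      _ ≤ (t + 1) ^ (2 * k) * Nat.factorial (k + 1) * ((t + 1) ^ 2 * (k + 2) * Q.ncard) := by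
        gcongr
        exact hR.trans (Nat.mul_le_mul_right _ hfactor)
      _ = (t + 1) ^ (2 * (k + 1)) * Nat.factorial (k + 1 + 1) * Q.ncard := by
        rw [Nat.factorial_succ (k + 1)]
        ring
end

section
/- Let G be a graph containing a vertex z with t pairwise internally disjoint paths of length at least 1 from z to t distinct vertices w_1, ..., w_t (a subdivision of K_{1,t} centered at z with leaves w_1, ..., w_t), all contained in a set C′, and suppose z has a neighbor set or is connected to a connected subgraph C disjoint from C′ that also contains a subdivision of K_{1,t} whose leaves are matched by edges to the leaves w_1, ..., w_t. More precisely: if G contains two vertex-disjoint subdivisions of K_{1,t} whose leaf sets are joined by a perfect matching of t edges between them, then G contains a K_{2,t} minor. -/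
open SimpleGraph

/-- The union of the supports of walks issuing from a common vertex induces a connected subgraph. -/
theorem SimpleGraph.connected_induce_iUnion_support {V ι : Type*} [Nonempty ι]
    (G : SimpleGraph V) (z : V) (w : ι → V) (p : (i : ι) → G.Walk z (w i)) :
    (G.induce (⋃ i, {v | v ∈ (p i).support})).Connected := by
  have hz : z ∈ ⋃ i, {v | v ∈ (p i).support} :=
    Set.mem_iUnion.2 ⟨Classical.arbitrary ι, (p _).start_mem_support⟩
  refine G.induce_connected_of_patches z hz fun {v} hv => ?_
  obtain ⟨i, hi⟩ := Set.mem_iUnion.1 hv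
  exact ⟨{v | v ∈ (p i).support}, Set.subset_iUnion (fun i => {v | v ∈ (p i).support}) i,
    (p i).start_mem_support, hi, (p i).connected_induce_support.preconnected _ _⟩

/-- If `G` contains two vertex-disjoint subdivisions of `K_{1,t}` (centers `z₁, z₂`,
leaves `w₁ i`, `w₂ i`, star paths pairwise sharing only their center) whose leaf sets are
joined by a perfect matching of `t` edges (`w₁ i` adjacent to `w₂ i`), then `G` contains a
`K_{2,t}` minor. -/
theorem K2t_minor_of_matched_stars {V : Type*} (t : ℕ) (ht : 1 ≤ t)
    (G : SimpleGraph V) (z₁ z₂ : V) (w₁ w₂ : Fin t → V)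
    (hw₁ : Function.Injective w₁) (hw₂ : Function.Injective w₂)
    (hz₁ : ∀ i, w₁ i ≠ z₁) (hz₂ : ∀ i, w₂ i ≠ z₂)
    (p₁ : (i : Fin t) → G.Walk z₁ (w₁ i)) (p₂ : (i : Fin t) → G.Walk z₂ (w₂ i))
    (hp₁ : ∀ i, (p₁ i).IsPath) (hp₂ : ∀ i, (p₂ i).IsPath)
    (hint₁ : ∀ i j, i ≠ j → ∀ x ∈ (p₁ i).support, x ∈ (p₁ j).support → x = z₁)
    (hint₂ : ∀ i j, i ≠ j → ∀ x ∈ (p₂ i).support, x ∈ (p₂ j).support → x = z₂)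
    (hdisj : ∀ i j, ∀ x ∈ (p₁ i).support, x ∉ (p₂ j).support)
    (hmatch : ∀ i, G.Adj (w₁ i) (w₂ i)) :
    G.HasMinor (completeBipartiteGraph (Fin 2) (Fin t)) := by
  have : Nonempty (Fin t) := ⟨⟨0, ht⟩⟩
  have hnil : ∀ i, ¬ (p₁ i).Nil := fun i h => hz₁ i h.eq.symm
  have hsub : ∀ i x, x ∈ (p₁ i).tail.support → x ∈ (p₁ i).support := fun i x hx => by
    rw [← Walk.cons_support_tail (hnil i)]
    exact List.mem_cons_of_mem _ hx
  have hstart : ∀ i, z₁ ∉ (p₁ i).tail.support := fun i => by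
    have h := (hp₁ i).support_nodup
    rw [← Walk.cons_support_tail (hnil i)] at h
    exact (List.nodup_cons.1 h).1
  let hub : Fin 2 → Set V := ![{z₁}, ⋃ i, {v | v ∈ (p₂ i).support}]
  let B : Fin 2 ⊕ Fin t → Set V := Sum.elim hub fun i => {v | v ∈ (p₁ i).tail.support}
  have hconn : ∀ w, (G.induce (B w)).Connected := by
    rintro (a | i)
    · fin_cases a
      · have hset : B (Sum.inl 0) = {v | v ∈ (Walk.nil : G.Walk z₁ z₁).support} := by
          simp [B, hub]
        exact hset ▸ Walk.connected_induce_support _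
      · exact G.connected_induce_iUnion_support z₂ w₂ p₂
    · exact (p₁ i).tail.connected_induce_support
  have hhubs : Disjoint (hub 0) (hub 1) := by
    refine Set.disjoint_left.2 fun x hx hx' => ?_
    obtain ⟨j, hj⟩ := Set.mem_iUnion.1 hx'
    obtain rfl : x = z₁ := hx
    exact hdisj j j _ (p₁ j).start_mem_support hj
  have hspoke : ∀ a i, Disjoint (hub a) (B (Sum.inr i)) := by
    refine fun a i => Set.disjoint_left.2 fun x hx hx' => ?_
    fin_cases a
    · obtain rfl : x = z₁ := hx
      exact hstart i hx'
    · obtain ⟨j, hj⟩ := Set.mem_iUnion.1 hx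
      exact hdisj i j x (hsub i x hx') hj
  have hadj : ∀ a i, ∃ x ∈ hub a, ∃ y ∈ B (Sum.inr i), G.Adj x y := by
    intro a i
    fin_cases a
    · exact ⟨z₁, rfl, _, (p₁ i).tail.start_mem_support, (p₁ i).adj_snd (hnil i)⟩
    · exact ⟨w₂ i, Set.mem_iUnion.2 ⟨i, (p₂ i).end_mem_support⟩, w₁ i,
        (p₁ i).tail.end_mem_support, (hmatch i).symm⟩
  refine ⟨B, fun w => Set.nonempty_coe_sort.1 (hconn w).nonempty, hconn, ?_, ?_⟩
  · rintro (a | i) (b | j) hne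
    · fin_cases a <;> fin_cases b
      · exact absurd rfl hne
      · exact hhubs
      · exact hhubs.symm
      · exact absurd rfl hne
    · exact hspoke a j
    · exact (hspoke b i).symm
    · refine Set.disjoint_left.2 fun x hx hx' => hstart i ?_
      have hij : i ≠ j := fun h => hne (congrArg Sum.inr h)
      obtain rfl : x = z₁ := hint₁ i j hij x (hsub i x hx) (hsub j x hx')
      exact hx
  · rintro (a | i) (b | j) h
    · simp at h
    · exact hadj a j
    · obtain ⟨x, hx, y, hy, hxy⟩ := hadj b i
      exact ⟨y, hy, x, hx, hxy.symm⟩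
    · simp at h
end
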